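/- arXiv:2007.01168 — 2 statements merged into one kernel-verified Lean document; each statement's English description precedes it below -/
import Mathlib

section
/- Let T be a tilting module over an artin algebra Λ (pd T ≤ 1, Ext^1_Λ(T,T) = 0, and there is an exact sequence 0 → Λ → T_0 → T_1 → 0 with T_0, T_1 ∈ add T). Then Gen T = {X ∈ mod Λ : Ext^1_Λ(T, X) = 0}, and (Gen T, T^{⊥0}) is a torsion pair in mod Λ whose torsion class Gen T contains every injective Λ-module; hence (Gen T, T^{⊥0}) is a tilting torsion pair. -/
universe u

/-- `M` belongs to `add T`: it is a direct summand of a finite direct sum of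
copies of `T`. -/
def MemAdd (Λ : Type u) [Ring Λ] (T : Type u) [AddCommGroup T] [Module Λ T]
    (M : Type u) [AddCommGroup M] [Module Λ M] : Prop :=
  ∃ (n : ℕ) (ι : M →ₗ[Λ] (Fin n → T)) (π : (Fin n → T) →ₗ[Λ] M),
    π ∘ₗ ι = LinearMap.id

/-- `M` belongs to `Gen T`: it is an epimorphic image of a finite direct sum
of copies of `T`. -/
def MemGen (Λ : Type u) [Ring Λ] (T : Type u) [AddCommGroup T] [Module Λ T]
    (M : Type u) [AddCommGroup M] [Module Λ M] : Prop :=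
  ∃ (n : ℕ) (π : (Fin n → T) →ₗ[Λ] M), Function.Surjective π

/-- `Ext¹_Λ(X, Y) = 0`: every short exact sequence `0 → Y → E → X → 0` of
finitely generated `Λ`-modules splits. -/
def Ext1Vanishes (Λ : Type u) [Ring Λ] (X : Type u) [AddCommGroup X] [Module Λ X]
    (Y : Type u) [AddCommGroup Y] [Module Λ Y] : Prop :=
  ∀ (E : Type u) [AddCommGroup E] [Module Λ E] [Module.Finite Λ E]
    (f : Y →ₗ[Λ] E) (g : E →ₗ[Λ] X),
    Function.Injective f → Function.Surjective g →
    LinearMap.range f = LinearMap.ker g →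
    ∃ s : X →ₗ[Λ] E, g ∘ₗ s = LinearMap.id

/-- `pd_Λ T ≤ 1`: some (finite) projective presentation of `T` has projective
kernel, i.e. there is an exact sequence `0 → P₁ → P₀ → T → 0` with `P₀`, `P₁`
projective. -/
def PdLeOne (Λ : Type u) [Ring Λ] (T : Type u) [AddCommGroup T] [Module Λ T] : Prop :=
  ∃ (n : ℕ) (π : (Fin n → Λ) →ₗ[Λ] T), Function.Surjective π ∧
    Module.Projective Λ (LinearMap.ker π)

/-- `Hom_Λ(T, M) = 0`, i.e. `M ∈ T^{⊥₀}`. -/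
def HomZero (Λ : Type u) [Ring Λ] (T : Type u) [AddCommGroup T] [Module Λ T]
    (M : Type u) [AddCommGroup M] [Module Λ M] : Prop :=
  ∀ f : T →ₗ[Λ] M, f = 0

/-- `T` is a tilting `Λ`-module: `pd T ≤ 1`, `Ext¹(T, T) = 0` and there is an
exact sequence `0 → Λ → T₀ → T₁ → 0` with `T₀, T₁ ∈ add T` (encoded by an
embedding `Λ ↪ T^n` whose cokernel lies in `add T`, which is equivalent). -/
def IsTiltingModule (Λ : Type u) [Ring Λ] (T : Type u) [AddCommGroup T]
    [Module Λ T] : Prop :=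
  PdLeOne Λ T ∧ Ext1Vanishes Λ T T ∧
    ∃ (n : ℕ) (f : Λ →ₗ[Λ] (Fin n → T)), Function.Injective f ∧
      MemAdd Λ T ((Fin n → T) ⧸ LinearMap.range f)

/-- Extension criterion: every map from `ker p` to `Y` extends. -/
def Tilt.ExtProp {Λ : Type u} [Ring Λ] {T : Type u} [AddCommGroup T] [Module Λ T]
    {n : ℕ} (p : (Fin n → Λ) →ₗ[Λ] T) (Y : Type u) [AddCommGroup Y] [Module Λ Y] : Prop :=
  ∀ h : LinearMap.ker p →ₗ[Λ] Y, ∃ hext : (Fin n → Λ) →ₗ[Λ] Y,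
    ∀ k : LinearMap.ker p, hext k = h k

/-- Pushout: if an extension of `X` (pushed out along `g : A → X`) by `B / A` splits, then
`g` extends to `B`. -/
theorem Tilt.pushout {Λ : Type u} [Ring Λ] {A B X : Type u} [AddCommGroup A] [Module Λ A]
    [AddCommGroup B] [Module Λ B] [AddCommGroup X] [Module Λ X]
    {Q : Type u} [AddCommGroup Q] [Module Λ Q] [Module.Finite Λ X] [Module.Finite Λ B]
    (i : A →ₗ[Λ] B) (q : B →ₗ[Λ] Q) (hi : Function.Injective i) (hq : Function.Surjective q)
    (hex : LinearMap.range i = LinearMap.ker q)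
    (g : A →ₗ[Λ] X)
    (H : ∀ (E : Type u) [AddCommGroup E] [Module Λ E] [Module.Finite Λ E]
      (f : X →ₗ[Λ] E) (r : E →ₗ[Λ] Q), Function.Injective f → Function.Surjective r →
      LinearMap.range f = LinearMap.ker r → ∃ s : Q →ₗ[Λ] E, r ∘ₗ s = LinearMap.id) :
    ∃ g' : B →ₗ[Λ] X, ∀ a, g' (i a) = g a := by
  let D : Submodule Λ (X × B) := LinearMap.range (LinearMap.prod g (-i))
  let f : X →ₗ[Λ] ((X × B) ⧸ D) := D.mkQ ∘ₗ LinearMap.inl Λ X B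
  let b : B →ₗ[Λ] ((X × B) ⧸ D) := D.mkQ ∘ₗ LinearMap.inr Λ X B
  have hD : D ≤ LinearMap.ker (q ∘ₗ LinearMap.snd Λ X B) := by
    rintro _ ⟨a, rfl⟩
    have : i a ∈ LinearMap.ker q := hex ▸ ⟨a, rfl⟩
    simpa using this
  let r : ((X × B) ⧸ D) →ₗ[Λ] Q := D.liftQ (q ∘ₗ LinearMap.snd Λ X B) hD
  have hr : ∀ x y, r (D.mkQ (x, y)) = q y := fun x y => by simp [r]
  have hfb : ∀ a, f (g a) = b (i a) := by
    intro a
    have : D.mkQ (g a, - i a) = 0 := by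
      rw [Submodule.mkQ_apply, Submodule.Quotient.mk_eq_zero]
      exact ⟨a, rfl⟩
    have h2 : f (g a) - b (i a) = D.mkQ (g a, - i a) := by
      simp only [f, b, LinearMap.comp_apply, ← map_sub]
      simp
    rw [this] at h2
    exact sub_eq_zero.mp h2
  have hf : Function.Injective f := by
    rw [injective_iff_map_eq_zero]
    intro x hx
    simp only [f, LinearMap.comp_apply, Submodule.mkQ_apply,
      Submodule.Quotient.mk_eq_zero] at hx
    obtain ⟨a, ha⟩ := hx
    have h1 : g a = x := congrArg Prod.fst ha
    have h2 : -i a = 0 := congrArg Prod.snd ha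
    have h3 : a = 0 := hi (by rw [map_zero]; exact neg_eq_zero.mp h2)
    rw [← h1, h3, map_zero]
  have hrs : Function.Surjective r := by
    intro y
    obtain ⟨z, rfl⟩ := hq y
    exact ⟨D.mkQ (0, z), hr _ _⟩
  have hfr : LinearMap.range f = LinearMap.ker r := by
    apply le_antisymm
    · rintro _ ⟨x, rfl⟩
      change r (D.mkQ (x, 0)) = 0
      rw [hr, map_zero]
    · intro e he
      obtain ⟨⟨x, y⟩, rfl⟩ := D.mkQ_surjective e
      have hy : q y = 0 := by rw [← hr x y]; exact he
      have : y ∈ LinearMap.range i := hex ▸ hy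
      obtain ⟨a, rfl⟩ := this
      refine ⟨x + g a, ?_⟩
      rw [map_add, hfb]
      simp only [f, b, LinearMap.comp_apply, ← map_add]
      simp
  obtain ⟨s, hs⟩ := H _ f r hf hrs hfr
  have key : ∀ y : B, ∃ x : X, f x = b y - s (q y) := by
    intro y
    have : b y - s (q y) ∈ LinearMap.range f := by
      rw [hfr, LinearMap.mem_ker, map_sub, ← LinearMap.comp_apply r s, hs]
      change r (D.mkQ (0, y)) - _ = 0
      rw [hr]
      simp
    exact this
  choose c hc using key
  refine ⟨⟨⟨c, ?_⟩, ?_⟩, ?_⟩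
  · intro y z
    apply hf
    simp only [map_add, hc]
    abel
  · intro l y
    apply hf
    simp only [map_smul, hc, RingHom.id_apply, smul_sub]
  · intro a
    apply hf
    change f (c (i a)) = _
    have : q (i a) = 0 := by
      have : i a ∈ LinearMap.ker q := hex ▸ ⟨a, rfl⟩
      exact this
    rw [hc, hfb, this, map_zero, sub_zero]

/-- If the extension criterion holds then maps out of `T` lift along epimorphisms with
kernel `Y`. -/
theorem Tilt.lift {Λ : Type u} [Ring Λ] {T : Type u} [AddCommGroup T] [Module Λ T]
    {n : ℕ} {p : (Fin n → Λ) →ₗ[Λ] T} (hp : Function.Surjective p)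
    {Y : Type u} [AddCommGroup Y] [Module Λ Y] (hY : Tilt.ExtProp p Y)
    {E Q : Type u} [AddCommGroup E] [Module Λ E] [AddCommGroup Q] [Module Λ Q]
    (f : Y →ₗ[Λ] E) (g : E →ₗ[Λ] Q)
    (hf : Function.Injective f) (hg : Function.Surjective g)
    (hfg : LinearMap.range f = LinearMap.ker g) (t : T →ₗ[Λ] Q) :
    ∃ s : T →ₗ[Λ] E, g ∘ₗ s = t := by
  obtain ⟨l, hl⟩ := Module.projective_lifting_property g (t ∘ₗ p) hg
  have hl' : ∀ x, g (l x) = t (p x) := fun x => LinearMap.congr_fun hl x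
  have key : ∀ k : LinearMap.ker p, ∃ y : Y, f y = l k := by
    intro k
    have : l k ∈ LinearMap.range f := by
      rw [hfg, LinearMap.mem_ker, hl', LinearMap.mem_ker.mp k.2, map_zero]
    exact this
  choose c hc using key
  let h : LinearMap.ker p →ₗ[Λ] Y :=
    { toFun := c
      map_add' := fun a b => hf (by simp [hc])
      map_smul' := fun a b => hf (by simp [hc]) }
  obtain ⟨h', hh'⟩ := hY h
  let d : (Fin n → Λ) →ₗ[Λ] E := l - f ∘ₗ h'
  have hd : LinearMap.ker p ≤ LinearMap.ker d := by
    intro k hk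
    have h1 : h' k = c ⟨k, hk⟩ := hh' ⟨k, hk⟩
    have h2 := hc ⟨k, hk⟩
    simp [d, h1, h2]
  let e := p.quotKerEquivOfSurjective hp
  let s : T →ₗ[Λ] E := ((LinearMap.ker p).liftQ d hd) ∘ₗ e.symm.toLinearMap
  have hs : ∀ x, s (p x) = d x := by
    intro x
    have : e.symm (p x) = (LinearMap.ker p).mkQ x := by
      rw [LinearEquiv.symm_apply_eq]
      rfl
    change (LinearMap.ker p).liftQ d hd (e.symm (p x)) = d x
    rw [this]
    simp
  refine ⟨s, ?_⟩
  ext y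
  obtain ⟨x, rfl⟩ := hp y
  have : g (f (h' x)) = 0 := by
    have : f (h' x) ∈ LinearMap.ker g := hfg ▸ ⟨_, rfl⟩
    exact this
  rw [LinearMap.comp_apply, hs]
  simp [d, hl', this]

theorem Tilt.ext_iff {Λ : Type u} [Ring Λ] {T : Type u} [AddCommGroup T] [Module Λ T]
    {n : ℕ} {p : (Fin n → Λ) →ₗ[Λ] T} (hp : Function.Surjective p)
    (Y : Type u) [AddCommGroup Y] [Module Λ Y] [Module.Finite Λ Y] :
    Ext1Vanishes Λ T Y ↔ Tilt.ExtProp p Y := by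
  constructor
  · intro H h
    exact Tilt.pushout (LinearMap.ker p).subtype p (Submodule.subtype_injective _) hp
      (Submodule.range_subtype _) h H
  · intro H E _ _ _ f g hf hg hfg
    exact Tilt.lift hp H f g hf hg hfg LinearMap.id

theorem Tilt.gen_ext {Λ : Type u} [Ring Λ] {T : Type u} [AddCommGroup T] [Module Λ T]
    {n : ℕ} {p : (Fin n → Λ) →ₗ[Λ] T} (hproj : Module.Projective Λ (LinearMap.ker p))
    (hTT : Tilt.ExtProp p T)
    {Y : Type u} [AddCommGroup Y] [Module Λ Y] (hY : MemGen Λ T Y) : Tilt.ExtProp p Y := by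
  obtain ⟨m, q, hq⟩ := hY
  intro h
  obtain ⟨l, hl⟩ := Module.projective_lifting_property q h hq
  choose c hc using fun j : Fin m => hTT (LinearMap.proj j ∘ₗ l)
  refine ⟨q ∘ₗ LinearMap.pi c, fun k => ?_⟩
  rw [← hl, LinearMap.comp_apply, LinearMap.comp_apply]
  congr 1
  ext j
  exact hc j k

theorem Tilt.gen_of_fintype {Λ : Type u} [Ring Λ] {T : Type u} [AddCommGroup T] [Module Λ T]
    {X : Type u} [AddCommGroup X] [Module Λ X] {ι : Type} [Finite ι]
    (q : (ι → T) →ₗ[Λ] X) (hq : Function.Surjective q) : MemGen Λ T X := by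
  obtain ⟨k, ⟨e⟩⟩ := Finite.exists_equiv_fin ι
  let e' := LinearEquiv.funCongrLeft Λ T e
  exact ⟨k, q ∘ₗ e'.toLinearMap, hq.comp e'.surjective⟩

theorem Tilt.ext_gen {Λ : Type u} [Ring Λ] {T : Type u} [AddCommGroup T] [Module Λ T]
    [Module.Finite Λ T]
    {n : ℕ} {p : (Fin n → Λ) →ₗ[Λ] T} (hp : Function.Surjective p)
    {m : ℕ} (f : Λ →ₗ[Λ] (Fin m → T)) (hf : Function.Injective f)
    (hadd : MemAdd Λ T ((Fin m → T) ⧸ LinearMap.range f))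
    {X : Type u} [AddCommGroup X] [Module Λ X] [Module.Finite Λ X]
    (hX : Tilt.ExtProp p X) : MemGen Λ T X := by
  obtain ⟨k, i, r, hir⟩ := hadd
  have ext1 : ∀ g : Λ →ₗ[Λ] X, ∃ g' : (Fin m → T) →ₗ[Λ] X, ∀ a, g' (f a) = g a := by
    intro g
    refine Tilt.pushout f (LinearMap.range f).mkQ hf (Submodule.mkQ_surjective _)
      (Submodule.ker_mkQ _).symm g ?_
    intro E _ _ _ a b ha hb hab
    choose s hs using fun j : Fin k =>
      Tilt.lift hp hX a b ha hb hab (r ∘ₗ LinearMap.single Λ (fun _ => T) j)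
    refine ⟨(LinearMap.lsum Λ (fun _ => T) ℕ s) ∘ₗ i, ?_⟩
    rw [← LinearMap.comp_assoc, ← hir]
    congr 1
    apply LinearMap.pi_ext'
    intro j
    rw [← hs j]
    ext x
    simp [LinearMap.lsum_apply, Pi.single_apply, apply_ite]
  obtain ⟨d, q, hq⟩ := Module.Finite.exists_fin' Λ X
  choose c hc using fun j : Fin d => ext1 (q ∘ₗ LinearMap.single Λ (fun _ => Λ) j)
  let Φ : (Fin d × Fin m → T) →ₗ[Λ] X :=
    ∑ j, c j ∘ₗ LinearMap.pi (fun l => LinearMap.proj (j, l))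
  refine Tilt.gen_of_fintype Φ ?_
  intro x
  obtain ⟨v, rfl⟩ := hq x
  refine ⟨fun jl => f (v jl.1) jl.2, ?_⟩
  have h1 : ∀ j, (LinearMap.pi (fun l => LinearMap.proj (j, l)) :
      (Fin d × Fin m → T) →ₗ[Λ] (Fin m → T)) (fun jl => f (v jl.1) jl.2) = f (v j) := by
    intro j; ext l; simp
  simp only [Φ, LinearMap.sum_apply, LinearMap.comp_apply, h1, hc]
  rw [← map_sum]
  congr 1
  exact LinearMap.sum_single_apply (fun _ => Λ) v

theorem Tilt.torsion {Λ : Type u} [Ring Λ] {T : Type u} [AddCommGroup T] [Module Λ T]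
    {n : ℕ} {p : (Fin n → Λ) →ₗ[Λ] T} (hp : Function.Surjective p)
    (hproj : Module.Projective Λ (LinearMap.ker p)) (hTT : Tilt.ExtProp p T)
    (M : Type u) [AddCommGroup M] [Module Λ M] [IsNoetherian Λ M] :
    ∃ K : Submodule Λ M, MemGen Λ T K ∧ HomZero Λ T (M ⧸ K) := by
  let S : Set (Submodule Λ M) := {K | MemGen Λ T K}
  have hS : S.Nonempty := ⟨⊥, 0, 0, fun x => ⟨0, Subsingleton.elim _ _⟩⟩
  obtain ⟨K, hK, hmax⟩ := set_has_maximal_iff_noetherian.mpr inferInstance S hS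
  refine ⟨K, hK, fun t => ?_⟩
  obtain ⟨g, hg⟩ := Tilt.lift hp (Tilt.gen_ext hproj hTT hK) K.subtype K.mkQ
    (Submodule.subtype_injective _) (Submodule.mkQ_surjective _) (by simp) t
  obtain ⟨m, q, hq⟩ := hK
  have hmem : K ⊔ LinearMap.range g ∈ S := by
    let Ψ : (Option (Fin m) → T) →ₗ[Λ] M :=
      K.subtype ∘ₗ q ∘ₗ LinearMap.pi (fun j => LinearMap.proj (some j)) +
        g ∘ₗ LinearMap.proj none
    have hΨ : ∀ v, Ψ v = q (fun j => v (some j)) + g (v none) := fun v => rfl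
    refine Tilt.gen_of_fintype (Ψ.codRestrict (K ⊔ LinearMap.range g) ?_) ?_
    · intro v
      rw [hΨ]
      exact Submodule.add_mem_sup (q _).2 ⟨_, rfl⟩
    · rintro ⟨x, hx⟩
      obtain ⟨y, hy, z, ⟨w, rfl⟩, rfl⟩ := Submodule.mem_sup.mp hx
      obtain ⟨v, hv⟩ := hq ⟨y, hy⟩
      refine ⟨fun o => o.elim w v, Subtype.ext ?_⟩
      change Ψ _ = y + g w
      rw [hΨ]
      simp only [Option.elim]
      rw [show q (fun j => v j) = ⟨y, hy⟩ from hv]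
  have hle : LinearMap.range g ≤ K := by
    by_contra hcon
    refine hmax _ hmem (lt_of_le_of_ne le_sup_left fun h => hcon ?_)
    rw [h]
    exact le_sup_right
  rw [← hg]
  ext x
  simpa using hle ⟨x, rfl⟩

theorem Tilt.embed {Λ : Type u} [Ring Λ] {T : Type u} [AddCommGroup T] [Module Λ T]
    {m : ℕ} (f : Λ →ₗ[Λ] (Fin m → T)) (hf : Function.Injective f)
    (M : Type u) [AddCommGroup M] [Module Λ M] [Module.Finite Λ M] :
    ∃ (n : ℕ) (N : Submodule Λ (Fin n → T))
        (f : M →ₗ[Λ] ((Fin n → T) ⧸ N)), Function.Injective f := by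
  obtain ⟨d, q, hq⟩ := Module.Finite.exists_fin' Λ M
  let e := LinearEquiv.funCongrLeft Λ T (finProdFinEquiv (m := d) (n := m)).symm
  let F0 : (Fin d → Λ) →ₗ[Λ] (Fin d × Fin m → T) :=
    LinearMap.pi fun jl => LinearMap.proj jl.2 ∘ₗ f ∘ₗ LinearMap.proj jl.1
  have hF0 : Function.Injective F0 := by
    intro v w h
    ext j
    apply hf
    ext l
    exact congrFun h (j, l)
  let F : (Fin d → Λ) →ₗ[Λ] (Fin (d * m) → T) := e.toLinearMap ∘ₗ F0
  have hF : Function.Injective F := e.injective.comp hF0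
  let N := (LinearMap.ker q).map F
  let G : ((Fin d → Λ) ⧸ LinearMap.ker q) →ₗ[Λ] ((Fin (d * m) → T) ⧸ N) :=
    (LinearMap.ker q).mapQ N F (Submodule.le_comap_map _ _)
  have hG : Function.Injective G := by
    rw [← LinearMap.ker_eq_bot, Submodule.ker_mapQ, Submodule.comap_map_eq_of_injective hF]
    simp
  let e2 := q.quotKerEquivOfSurjective hq
  exact ⟨d * m, N, G ∘ₗ e2.symm.toLinearMap, hG.comp e2.symm.injective⟩

/-- Let `Λ` be an artin algebra (a finitely generated algebra over a
commutative artinian ring `R`) and `T` a tilting `Λ`-module. Then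
`Gen T = {X : Ext¹(T, X) = 0}`, `(Gen T, T^{⊥₀})` is a torsion pair in
`mod Λ` whose torsion class contains all injective modules; hence it is a
tilting torsion pair (every module embeds into a module in `Gen T`). -/
theorem stmt18 (R : Type u) [CommRing R] [IsArtinianRing R]
    (Λ : Type u) [Ring Λ] [Algebra R Λ] [Module.Finite R Λ]
    (T : Type u) [AddCommGroup T] [Module Λ T] [Module.Finite Λ T]
    (hT : IsTiltingModule Λ T) :
    -- `Gen T = {X ∈ mod Λ : Ext¹_Λ(T, X) = 0}`
    (∀ (X : Type u) [AddCommGroup X] [Module Λ X] [Module.Finite Λ X],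
      MemGen Λ T X ↔ Ext1Vanishes Λ T X) ∧
    -- `Hom(Gen T, T^{⊥₀}) = 0`
    (∀ (X : Type u) [AddCommGroup X] [Module Λ X] [Module.Finite Λ X]
      (Y : Type u) [AddCommGroup Y] [Module Λ Y] [Module.Finite Λ Y],
      MemGen Λ T X → HomZero Λ T Y → ∀ f : X →ₗ[Λ] Y, f = 0) ∧
    -- every module has a torsion subobject in `Gen T` with torsion-free quotient
    (∀ (M : Type u) [AddCommGroup M] [Module Λ M] [Module.Finite Λ M],
      ∃ K : Submodule Λ M, MemGen Λ T K ∧ HomZero Λ T (M ⧸ K)) ∧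
    -- `Gen T` contains every injective module
    (∀ (I : Type u) [AddCommGroup I] [Module Λ I] [Module.Finite Λ I],
      Module.Injective Λ I → MemGen Λ T I) ∧
    -- hence `(Gen T, T^{⊥₀})` is tilting: every module embeds into an object of `Gen T`
    (∀ (M : Type u) [AddCommGroup M] [Module Λ M] [Module.Finite Λ M],
      ∃ (n : ℕ) (N : Submodule Λ (Fin n → T))
        (f : M →ₗ[Λ] ((Fin n → T) ⧸ N)), Function.Injective f) := by
  obtain ⟨⟨n, p, hp, hproj⟩, hTT, m, f, hf, hadd⟩ := hT
  rw [Tilt.ext_iff hp] at hTT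
  have : IsNoetherian R Λ := inferInstance
  have : IsNoetherianRing Λ := isNoetherian_of_tower R this
  refine ⟨?_, ?_, ?_, ?_, ?_⟩
  · intro X _ _ _
    rw [Tilt.ext_iff hp]
    exact ⟨Tilt.gen_ext hproj hTT, Tilt.ext_gen hp f hf hadd⟩
  · rintro X _ _ _ Y _ _ _ ⟨k, q, hq⟩ hY g
    have h0 : g ∘ₗ q = 0 := by
      apply LinearMap.pi_ext'
      intro j
      rw [LinearMap.zero_comp]
      exact hY _
    ext x
    obtain ⟨v, rfl⟩ := hq x
    exact LinearMap.congr_fun h0 v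
  · intro M _ _ _
    exact Tilt.torsion hp hproj hTT M
  · intro I _ _ _ hI
    refine Tilt.ext_gen hp f hf hadd fun h => ?_
    exact hI.out (LinearMap.ker p).subtype (Submodule.subtype_injective _) h
  · intro M _ _ _
    exact Tilt.embed f hf M
end

section
/- Let Λ be an artin algebra, T a partial tilting Λ-module (pd T ≤ 1 and Ext^1_Λ(T,T) = 0) such that (Gen T, T^{⊥0}) is a torsion pair in mod Λ whose torsion class Gen T contains all injective Λ-modules, and suppose every Ext-projective object of Gen T lies in add T (equivalently, add T = add P(Gen T)). Then T is a tilting Λ-module, i.e., there is an exact sequence 0 → Λ → T_0 → T_1 → 0 with T_0, T_1 ∈ add T. -/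
universe u

/-- Elements killed by the Jacobson radical lie in every essential submodule. -/
theorem aux_socle_le {Λ : Type u} [Ring Λ] [IsSemiprimaryRing Λ]
    {Q : Type u} [AddCommGroup Q] [Module Λ Q] (L : Submodule Λ Q)
    (hess : ∀ N : Submodule Λ Q, N ⊓ L = ⊥ → N = ⊥)
    (x : Q) (hx : ∀ j ∈ Ring.jacobson Λ, j • x = 0) : x ∈ L := by
  let S : Submodule Λ Q :=
    { carrier := {y | ∀ j ∈ Ring.jacobson Λ, j • y = 0}
      add_mem' := by
        intro a b ha hb j hj
        rw [smul_add, ha j hj, hb j hj, add_zero]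
      zero_mem' := by intro j _; simp
      smul_mem' := by
        intro c y hy j hj
        rw [smul_smul]
        exact hy _ (Ideal.mul_mem_right c _ hj) }
  have hS : Module.IsTorsionBySet Λ S (Ring.jacobson Λ) := by
    rintro ⟨y, hy⟩ ⟨j, hj⟩
    exact Subtype.ext (hy j hj)
  have hss : IsSemisimpleModule Λ S := by
    let _ := hS.module
    exact (hS.semilinearMap.isSemisimpleModule_iff_of_bijective Function.bijective_id).2
      inferInstance
  obtain ⟨C, hC⟩ := exists_isCompl (L.comap S.subtype)
  have hC0 : C.map S.subtype = ⊥ := by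
    apply hess
    rw [eq_bot_iff]
    rintro y ⟨⟨z, hz, rfl⟩, hy2⟩
    have : z ∈ (L.comap S.subtype) ⊓ C := ⟨hy2, hz⟩
    rw [hC.inf_eq_bot] at this
    simp at this
    simp [this]
  have hC1 : C = ⊥ := by
    rw [eq_bot_iff]
    intro z hz
    have : S.subtype z ∈ C.map S.subtype := ⟨z, hz, rfl⟩
    rw [hC0] at this
    simpa using this
  have htop : L.comap S.subtype = ⊤ := by
    have := hC.sup_eq_top
    rwa [hC1, sup_bot_eq] at this
  have : (⟨x, hx⟩ : S) ∈ L.comap S.subtype := by rw [htop]; trivial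
  exact this

/-- Essential extensions of a module of finite length over an artin algebra are finite. -/
theorem aux_finite_of_essential (R : Type u) [CommRing R] [IsNoetherianRing R]
    {Λ : Type u} [Ring Λ] [Algebra R Λ] [Module.Finite R Λ] [IsSemiprimaryRing Λ]
    {Q : Type u} [AddCommGroup Q] [Module Λ Q] [Module R Q] [IsScalarTower R Λ Q]
    (L : Submodule Λ Q) (hL : IsNoetherian R L)
    (hess : ∀ N : Submodule Λ Q, N ⊓ L = ⊥ → N = ⊥) : IsNoetherian R Q := by
  have hnil := IsSemiprimaryRing.isNilpotent (R := Λ)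
  set J := Ring.jacobson Λ with hJ
  obtain ⟨s, hs⟩ : (J.restrictScalars R).FG := IsNoetherian.noetherian _
  have key : ∀ k : ℕ, ∀ N : Submodule R Q, (∀ x ∈ N, ∀ j ∈ J ^ k, j • x = 0) →
      IsNoetherian R N := by
    intro k
    induction k with
    | zero =>
      intro N hN
      have : N = ⊥ := by
        rw [eq_bot_iff]
        intro x hx
        have := hN x hx 1 (by rw [Submodule.pow_zero, Ideal.one_eq_top]; trivial)
        simpa using this
      rw [this]
      infer_instance
    | succ k ih =>
      intro N hN
      have h1 : ∀ a : s, IsNoetherian R (N.map (Algebra.lsmul R R Q (a : Λ))) := by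
        intro a
        apply ih
        rintro _ ⟨x, hx, rfl⟩ j hj
        have ha : (a : Λ) ∈ J := by
          have : (a : Λ) ∈ J.restrictScalars R := hs ▸ Submodule.subset_span a.2
          exact this
        have := hN x hx (j * a) (by rw [Submodule.pow_succ]; exact Ideal.mul_mem_mul hj ha)
        rw [mul_smul] at this
        exact this
      let g : N →ₗ[R] (∀ a : s, N.map (Algebra.lsmul R R Q (a : Λ))) :=
        LinearMap.pi fun a => (Algebra.lsmul R R Q (a : Λ)).submoduleMap N
      have hker : ∀ z ∈ LinearMap.ker g, (z : Q) ∈ L := by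
        intro z hz
        apply aux_socle_le L hess
        intro j hj
        have hj' : j ∈ Submodule.span R (s : Set Λ) := by rw [hs]; exact hj
        induction hj' using Submodule.span_induction with
        | mem a ha =>
          have := congrArg Subtype.val (congrFun (show g z = 0 from hz) ⟨a, ha⟩)
          exact this
        | zero => simp
        | add a b ha hb h1 h2 =>
          rw [add_smul, h1 (by rw [hs] at ha; exact ha), h2 (by rw [hs] at hb; exact hb), add_zero]
        | smul r a ha h1 =>
          rw [smul_assoc, h1 (by rw [hs] at ha; exact ha), smul_zero]
      have hkn : IsNoetherian R (LinearMap.ker g) := by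
        let f : LinearMap.ker g →ₗ[R] (L.restrictScalars R) :=
          LinearMap.codRestrict _ (N.subtype ∘ₗ (LinearMap.ker g).subtype)
            (fun z => hker z.1 z.2)
        have : IsNoetherian R (L.restrictScalars R) := hL
        refine isNoetherian_of_injective f ?_
        intro a b hab
        have := congrArg Subtype.val hab
        exact Subtype.ext (Subtype.ext this)
      exact isNoetherian_of_range_eq_ker (LinearMap.ker g).subtype g (by simp)
  obtain ⟨n, hn⟩ := hnil
  have : IsNoetherian R (⊤ : Submodule R Q) := by
    apply key n
    intro x _ j hj
    rw [hn] at hj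
    have : j = 0 := by simpa using hj
    simp [this]
  exact isNoetherian_top_iff.mp this

/-- Over an artin algebra `Λ`, the regular module embeds into a finitely generated injective. -/
theorem aux_exists_injective (R : Type u) [CommRing R] [IsArtinianRing R]
    (Λ : Type u) [Ring Λ] [Algebra R Λ] [Module.Finite R Λ] :
    ∃ (I : Type u) (_ : AddCommGroup I) (_ : Module Λ I), Module.Finite Λ I ∧
      Module.Injective Λ I ∧ ∃ i : Λ →ₗ[Λ] I, Function.Injective i := by
  have hart : IsArtinianRing Λ := IsArtinianRing.of_finite R Λ
  obtain ⟨P⟩ := CategoryTheory.EnoughInjectives.presentation (ModuleCat.of Λ Λ)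
  let E : Type u := P.J
  have hE : Module.Injective Λ E := by
    have := P.injective
    exact Module.injective_module_of_injective_object Λ P.J
  let e : Λ →ₗ[Λ] E := P.f.hom
  have he : Function.Injective e := by
    have := P.mono
    exact (ModuleCat.mono_iff_injective P.f).1 this
  clear_value e
  obtain ⟨K, hK⟩ := zorn_le₀ {K : Submodule Λ E | Disjoint (LinearMap.range e) K} (by
    intro c hc hchain
    refine ⟨sSup c, ?_, fun z hz => le_sSup hz⟩
    show Disjoint _ _
    rw [hchain.directedOn.disjoint_sSup_right]
    exact fun b hb => hc hb)
  have hKd : Disjoint (LinearMap.range e) K := hK.prop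
  let i : Λ →ₗ[Λ] (E ⧸ K) := K.mkQ ∘ₗ e
  have hi : Function.Injective i := by
    rw [← LinearMap.ker_eq_bot, LinearMap.ker_eq_bot']
    intro x hx
    have hx' : e x ∈ K := by simpa [i] using hx
    have := (Submodule.disjoint_def.1 hKd) _ ⟨x, rfl⟩ hx'
    exact he (by simpa using this)
  have hess : ∀ N : Submodule Λ (E ⧸ K), N ⊓ LinearMap.range i = ⊥ → N = ⊥ := by
    intro N hN
    have h1 : K ≤ N.comap K.mkQ := by
      intro x hx
      have : K.mkQ x = 0 := by simpa using hx
      simp only [Submodule.mem_comap, this, zero_mem]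
    have h2 : Disjoint (LinearMap.range e) (N.comap K.mkQ) := by
      rw [Submodule.disjoint_def]
      rintro _ ⟨x, rfl⟩ hx
      have : i x ∈ N ⊓ LinearMap.range i := ⟨hx, ⟨x, rfl⟩⟩
      rw [hN] at this
      have : x = 0 := hi (by simpa using this)
      simp [this]
    have h3 := hK.le_of_ge h2 h1
    rw [eq_bot_iff]
    intro y hy
    obtain ⟨x, rfl⟩ := K.mkQ_surjective y
    have : x ∈ K := h3 hy
    simpa using this
  -- inject an essential extension
  have hinj_of : ∀ {M : Type u} [AddCommGroup M] [Module Λ M] (g : (E ⧸ K) →ₗ[Λ] M),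
      Function.Injective (g ∘ₗ i) → Function.Injective g := by
    intro M _ _ g hg
    rw [← LinearMap.ker_eq_bot]
    apply hess
    rw [eq_bot_iff]
    rintro _ ⟨h, ⟨x, rfl⟩⟩
    have : x = 0 := hg (by simpa using h)
    simp [this]
  let _ : Module R (E ⧸ K) := Module.compHom _ (algebraMap R Λ)
  have : IsScalarTower R Λ (E ⧸ K) := IsScalarTower.of_algebraMap_smul (fun _ _ => rfl)
  have hLn : IsNoetherian R (LinearMap.range i) := by
    have h : IsNoetherian R Λ := inferInstance
    exact isNoetherian_of_surjective (M := Λ) (i.rangeRestrict.restrictScalars R)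
      (LinearMap.range_eq_top.2 i.surjective_rangeRestrict)
  have hQn : IsNoetherian R (E ⧸ K) := aux_finite_of_essential R (LinearMap.range i) hLn hess
  have hfin : Module.Finite Λ (E ⧸ K) := Module.Finite.of_restrictScalars_finite R Λ (E ⧸ K)
  refine ⟨E ⧸ K, inferInstance, inferInstance, hfin, ?_, i, hi⟩
  obtain ⟨g, hg⟩ := hE.out i hi e
  have hgi : g ∘ₗ i = e := LinearMap.ext hg
  let h : (E ⧸ K) →ₗ[Λ] (E ⧸ K) := K.mkQ ∘ₗ g
  have hh : Function.Injective h := by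
    apply hinj_of
    have : h ∘ₗ i = i := by
      show (K.mkQ ∘ₗ g) ∘ₗ i = i
      rw [LinearMap.comp_assoc, hgi]
    rw [this]; exact hi
  have hb : Function.Bijective h := IsArtinian.bijective_of_injective_endomorphism h hh
  let he := LinearEquiv.ofBijective h hb
  refine ⟨fun X Y _ _ _ _ f hf u => ?_⟩
  obtain ⟨v, hv⟩ := hE.out f hf (g ∘ₗ u)
  refine ⟨he.symm.toLinearMap ∘ₗ K.mkQ ∘ₗ v, fun x => ?_⟩
  show he.symm (K.mkQ (v (f x))) = u x
  rw [hv, LinearEquiv.symm_apply_eq]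
  rfl

/-- If `Ext¹(T, Z) = 0`, then maps from the kernel of a finite free cover of `T` extend. -/
theorem aux_extend_of_ext {Λ : Type u} [Ring Λ] {T Z : Type u} [AddCommGroup T] [Module Λ T]
    [AddCommGroup Z] [Module Λ Z] [Module.Finite Λ Z] (hext : Ext1Vanishes Λ T Z)
    {n : ℕ} (π : (Fin n → Λ) →ₗ[Λ] T) (hπ : Function.Surjective π)
    (a : LinearMap.ker π →ₗ[Λ] Z) :
    ∃ b : (Fin n → Λ) →ₗ[Λ] Z, ∀ p : LinearMap.ker π, b p = a p := by
  let W : Submodule Λ (Z × (Fin n → Λ)) :=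
    LinearMap.range (LinearMap.prod (-a) (LinearMap.ker π).subtype)
  let f : Z →ₗ[Λ] ((Z × (Fin n → Λ)) ⧸ W) := W.mkQ ∘ₗ LinearMap.inl Λ Z (Fin n → Λ)
  have hW : W ≤ LinearMap.ker (π ∘ₗ LinearMap.snd Λ Z (Fin n → Λ)) := by
    rintro _ ⟨p, rfl⟩
    simp
  let g : ((Z × (Fin n → Λ)) ⧸ W) →ₗ[Λ] T := W.liftQ _ hW
  have hg : ∀ z y, g (W.mkQ (z, y)) = π y := fun z y => rfl
  have hf : Function.Injective f := by
    rw [← LinearMap.ker_eq_bot, LinearMap.ker_eq_bot']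
    intro z hz
    have hz' : ((z, 0) : Z × (Fin n → Λ)) ∈ W := by
      simpa [f] using hz
    obtain ⟨p, hp⟩ := hz'
    have h1 : -a p = z := congrArg Prod.fst hp
    have h2 : (p : Fin n → Λ) = 0 := congrArg Prod.snd hp
    have h3 : p = 0 := Subtype.ext h2
    rw [← h1, h3]; simp
  have hgs : Function.Surjective g := by
    intro t
    obtain ⟨y, rfl⟩ := hπ t
    exact ⟨W.mkQ (0, y), hg 0 y⟩
  have hrel : ∀ p : LinearMap.ker π, W.mkQ (0, (p : Fin n → Λ)) = f (a p) := by
    intro p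
    show W.mkQ (0, (p : Fin n → Λ)) = W.mkQ (a p, 0)
    rw [← sub_eq_zero, ← map_sub]
    simp only [Submodule.mkQ_apply, Submodule.Quotient.mk_eq_zero]
    exact ⟨p, by simp⟩
  have hex : LinearMap.range f = LinearMap.ker g := by
    apply le_antisymm
    · rintro _ ⟨z, rfl⟩
      show g (W.mkQ (z, 0)) = 0
      rw [hg, map_zero]
    · intro e he
      obtain ⟨⟨z, y⟩, rfl⟩ := W.mkQ_surjective e
      have hy : π y = 0 := by rw [← hg z y]; exact he
      refine ⟨z + a ⟨y, hy⟩, ?_⟩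
      rw [map_add, ← hrel ⟨y, hy⟩]
      show W.mkQ (z, 0) + W.mkQ (0, y) = _
      rw [← map_add]; simp
  obtain ⟨s, hs⟩ := hext _ f g hf hgs hex
  have hs' : ∀ t, g (s t) = t := fun t => LinearMap.congr_fun hs t
  let ef := LinearEquiv.ofInjective f hf
  let d : ((Z × (Fin n → Λ)) ⧸ W) →ₗ[Λ] LinearMap.range f :=
    LinearMap.codRestrict _ (LinearMap.id - s ∘ₗ g) (by
      intro e
      rw [hex]
      simp [hs'])
  refine ⟨ef.symm.toLinearMap ∘ₗ d ∘ₗ W.mkQ ∘ₗ LinearMap.inr Λ Z (Fin n → Λ), fun p => ?_⟩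
  show ef.symm (d (W.mkQ (0, (p : Fin n → Λ)))) = a p
  rw [LinearEquiv.symm_apply_eq]
  apply Subtype.ext
  show W.mkQ (0, (p : Fin n → Λ)) - s (g (W.mkQ (0, (p : Fin n → Λ)))) = f (a p)
  rw [hg, LinearMap.map_coe_ker, map_zero, sub_zero, hrel]

/-- If maps from the syzygy of `T` to `Y` extend, maps from `T` lift along extensions by `Y`. -/
theorem aux_lift {Λ : Type u} [Ring Λ] {T Y E C : Type u} [AddCommGroup T] [Module Λ T]
    [AddCommGroup Y] [Module Λ Y] [AddCommGroup E] [Module Λ E] [AddCommGroup C] [Module Λ C]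
    {n : ℕ} (π : (Fin n → Λ) →ₗ[Λ] T) (hπ : Function.Surjective π)
    (hY : ∀ a : LinearMap.ker π →ₗ[Λ] Y,
      ∃ b : (Fin n → Λ) →ₗ[Λ] Y, ∀ p : LinearMap.ker π, b p = a p)
    (f : Y →ₗ[Λ] E) (g : E →ₗ[Λ] C) (hf : Function.Injective f) (hg : Function.Surjective g)
    (hex : LinearMap.range f = LinearMap.ker g) (u : T →ₗ[Λ] C) :
    ∃ v : T →ₗ[Λ] E, g ∘ₗ v = u := by
  obtain ⟨w, hw⟩ := Module.projective_lifting_property g (u ∘ₗ π) hg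
  have hw' : ∀ x, g (w x) = u (π x) := fun x => LinearMap.congr_fun hw x
  let ef := LinearEquiv.ofInjective f hf
  let c : LinearMap.ker π →ₗ[Λ] LinearMap.range f :=
    LinearMap.codRestrict _ (w ∘ₗ (LinearMap.ker π).subtype) (by
      intro p
      rw [hex]
      simp [hw'])
  obtain ⟨b, hb⟩ := hY (ef.symm.toLinearMap ∘ₗ c)
  have hb' : ∀ p : LinearMap.ker π, f (b p) = w p := by
    intro p
    rw [hb]
    have : ef (ef.symm (c p)) = c p := ef.apply_symm_apply _
    exact congrArg Subtype.val this
  let k : (Fin n → Λ) →ₗ[Λ] E := w - f ∘ₗ b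
  have hk : LinearMap.ker π ≤ LinearMap.ker k := by
    intro p hp
    simp [k, hb' ⟨p, hp⟩]
  refine ⟨(LinearMap.ker π).liftQ k hk ∘ₗ (π.quotKerEquivOfSurjective hπ).symm.toLinearMap, ?_⟩
  ext t
  obtain ⟨x, rfl⟩ := hπ t
  have h1 : (π.quotKerEquivOfSurjective hπ).symm (π x) = (LinearMap.ker π).mkQ x := by
    rw [LinearEquiv.symm_apply_eq]; rfl
  have h2 : g (f (b x)) = 0 := by
    have : f (b x) ∈ LinearMap.ker g := hex ▸ ⟨_, rfl⟩
    exact this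
  simp only [LinearMap.comp_apply, LinearEquiv.coe_coe, h1]
  simp [k, hw', h2]

/-- Let `Λ` be an artin algebra (a finitely generated algebra over a
commutative artinian ring `R`) and `T` a partial tilting `Λ`-module
(`pd T ≤ 1`, `Ext¹(T, T) = 0`) such that `(Gen T, T^{⊥₀})` is a torsion pair
whose torsion class contains all injective modules, and such that every
Ext-projective object of `Gen T` lies in `add T`. Then `T` is a tilting
`Λ`-module, i.e. there is an exact sequence `0 → Λ → T₀ → T₁ → 0` with
`T₀, T₁ ∈ add T` (encoded by an embedding `Λ ↪ T^n = T₀ ∈ add T` whose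
cokernel `T₁` lies in `add T`). -/
theorem stmt19 (R : Type u) [CommRing R] [IsArtinianRing R]
    (Λ : Type u) [Ring Λ] [Algebra R Λ] [Module.Finite R Λ]
    (T : Type u) [AddCommGroup T] [Module Λ T] [Module.Finite Λ T]
    -- `T` is a partial tilting module
    (hpd : PdLeOne Λ T) (hext : Ext1Vanishes Λ T T)
    -- `(Gen T, T^{⊥₀})` is a torsion pair
    (htor : ∀ (M : Type u) [AddCommGroup M] [Module Λ M] [Module.Finite Λ M],
      ∃ K : Submodule Λ M, MemGen Λ T K ∧ HomZero Λ T (M ⧸ K))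
    -- whose torsion class `Gen T` contains all injective modules
    (hinj : ∀ (I : Type u) [AddCommGroup I] [Module Λ I] [Module.Finite Λ I],
      Module.Injective Λ I → MemGen Λ T I)
    -- every Ext-projective object of `Gen T` lies in `add T`
    (hextproj : ∀ (X : Type u) [AddCommGroup X] [Module Λ X] [Module.Finite Λ X],
      MemGen Λ T X →
      (∀ (Y : Type u) [AddCommGroup Y] [Module Λ Y] [Module.Finite Λ Y],
        MemGen Λ T Y → Ext1Vanishes Λ X Y) →
      MemAdd Λ T X) :
    -- then `T` is a tilting module
    ∃ (n : ℕ) (f : Λ →ₗ[Λ] (Fin n → T)), Function.Injective f ∧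
      MemAdd Λ T ((Fin n → T) ⧸ LinearMap.range f) := by
  obtain ⟨m, π, hπ, hproj⟩ := hpd
  have hart : IsArtinianRing Λ := IsArtinianRing.of_finite R Λ
  -- maps from the syzygy to objects of `Gen T` extend
  have hGenExt : ∀ (Y : Type u) [AddCommGroup Y] [Module Λ Y], MemGen Λ T Y →
      ∀ a : LinearMap.ker π →ₗ[Λ] Y,
      ∃ b : (Fin m → Λ) →ₗ[Λ] Y, ∀ p : LinearMap.ker π, b p = a p := by
    intro Y _ _ hY a
    obtain ⟨k, ρ, hρ⟩ := hY
    obtain ⟨c, hc⟩ := Module.projective_lifting_property ρ a hρ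
    choose b hb using fun i : Fin k =>
      aux_extend_of_ext hext π hπ (LinearMap.proj i ∘ₗ c)
    refine ⟨ρ ∘ₗ LinearMap.pi b, fun p => ?_⟩
    have h1 : LinearMap.pi b (p : Fin m → Λ) = c p := by
      ext i
      exact hb i p
    rw [LinearMap.comp_apply, h1]
    exact LinearMap.congr_fun hc p
  -- `R`-generators of `T`
  let _ : Module R T := Module.compHom T (algebraMap R Λ)
  have hst : IsScalarTower R Λ T := IsScalarTower.of_algebraMap_smul (fun _ _ => rfl)
  have hRT : Module.Finite R T := Module.Finite.trans Λ T
  obtain ⟨n, t, ht⟩ := Module.Finite.exists_fin (R := R) (M := T)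
  let f : Λ →ₗ[Λ] (Fin n → T) := LinearMap.toSpanSingleton Λ (Fin n → T) t
  -- every element of an object of `Gen T` is the image of `t`
  have happT : ∀ x : T, ∃ e : (Fin n → T) →ₗ[Λ] T, e t = x := by
    intro x
    have hx : x ∈ Submodule.span R (Set.range t) := by rw [ht]; trivial
    obtain ⟨r, hr⟩ := (Submodule.mem_span_range_iff_exists_fun R).1 hx
    have hcomm : SMulCommClass R Λ T := IsScalarTower.to_smulCommClass
    have hcomm' : SMulCommClass Λ R T := SMulCommClass.symm _ _ _
    refine ⟨∑ i, r i • (LinearMap.proj i : (Fin n → T) →ₗ[Λ] T), ?_⟩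
    rw [← hr]
    simp
  have happ : ∀ (Y : Type u) [AddCommGroup Y] [Module Λ Y], MemGen Λ T Y →
      ∀ y : Y, ∃ e : (Fin n → T) →ₗ[Λ] Y, e t = y := by
    intro Y _ _ hY y
    obtain ⟨k, ρ, hρ⟩ := hY
    obtain ⟨x, rfl⟩ := hρ y
    choose e he using fun i : Fin k => happT (x i)
    refine ⟨ρ ∘ₗ LinearMap.pi e, ?_⟩
    have : LinearMap.pi e t = x := by
      ext i
      exact he i
    rw [LinearMap.comp_apply, this]
  -- `f` is injective
  have hfinj : Function.Injective f := by
    obtain ⟨I, _, _, hIf, hI, i, hi⟩ := aux_exists_injective R Λ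
    obtain ⟨e, he⟩ := happ I (hinj I hI) (i 1)
    have : e ∘ₗ f = i := by
      ext
      simp [f, he]
    intro a b hab
    apply hi
    rw [← this, LinearMap.comp_apply, LinearMap.comp_apply, hab]
  refine ⟨n, f, hfinj, ?_⟩
  apply hextproj _ ⟨n, (LinearMap.range f).mkQ, (LinearMap.range f).mkQ_surjective⟩
  intro Y _ _ _ hY E _ _ _ f' g hf' hg hex
  choose v hv using fun i : Fin n =>
    aux_lift π hπ (hGenExt Y hY) f' g hf' hg hex
      ((LinearMap.range f).mkQ ∘ₗ LinearMap.single Λ (fun _ : Fin n => T) i)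
  let w : (Fin n → T) →ₗ[Λ] E := ∑ i, v i ∘ₗ LinearMap.proj i
  have hw : g ∘ₗ w = (LinearMap.range f).mkQ := by
    apply LinearMap.pi_ext'
    intro j
    rw [← hv j]
    ext x
    simp only [LinearMap.comp_apply]
    congr 1
    simp only [w, LinearMap.sum_apply, LinearMap.comp_apply, LinearMap.proj_apply,
      LinearMap.single_apply]
    rw [Finset.sum_eq_single j]
    · simp
    · intro b _ hb
      simp [Pi.single_eq_of_ne hb]
    · simp
  have hwt : w t ∈ LinearMap.range f' := by
    rw [hex]
    have h1 : g (w t) = (LinearMap.range f).mkQ t := LinearMap.congr_fun hw t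
    rw [LinearMap.mem_ker, h1]
    simp only [Submodule.mkQ_apply, Submodule.Quotient.mk_eq_zero]
    exact ⟨1, by simp [f]⟩
  obtain ⟨y, hy⟩ := hwt
  obtain ⟨e, he⟩ := happ Y hY y
  have hle : LinearMap.range f ≤ LinearMap.ker (w - f' ∘ₗ e) := by
    rintro _ ⟨a, rfl⟩
    simp [f, he, hy]
  refine ⟨(LinearMap.range f).liftQ _ hle, ?_⟩
  apply Submodule.linearMap_qext
  refine LinearMap.ext fun x => ?_
  have h2 : g (f' (e x)) = 0 := by
    have : f' (e x) ∈ LinearMap.ker g := hex ▸ ⟨_, rfl⟩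
    exact this
  have h1 : g (w x) = (LinearMap.range f).mkQ x := LinearMap.congr_fun hw x
  simp only [LinearMap.comp_apply, Submodule.mkQ_apply, Submodule.liftQ_apply,
    LinearMap.sub_apply, map_sub, h2, sub_zero, LinearMap.id_apply]
  exact h1
end
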